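/- Assume p = 1 and the absence of strict ε-arbitrage. Then for every G ∈ F_ε^⊥ there exists H ∈ 𝓗 such that (G•S)_T = (H•S)_T − ε‖H‖_1 P-a.s. -/

import Mathlib

open MeasureTheory Filter
open scoped ENNReal NNReal

noncomputable section

namespace QFTAP

/-- The `p`-norm on `ℝ^d`. -/
def pNorm {d : ℕ} (p : ℝ) (x : Fin d → ℝ) : ℝ := (∑ i, |x i| ^ p) ^ (1 / p)

/-- The norm dual to the `p`-norm, i.e. the `q`-norm where `1/p + 1/q = 1`
(`q = ∞` when `p = 1`, and `q = p/(p-1)` when `p > 1`). -/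
def qNorm {d : ℕ} (p : ℝ) (x : Fin d → ℝ) : ℝ :=
  if p = 1 then ⨆ i, |x i| else pNorm (p / (p - 1)) x

/-- Euclidean scalar product on `ℝ^d`. -/
def dot {d : ℕ} (x y : Fin d → ℝ) : ℝ := ∑ i, x i * y i

/-- The dual vector `x*` (with the convention `0* = 0`): `x*_i = sgn(x_i) |x_i|^{p-1} / |x|_p^{p-1}`. -/
def dualVec {d : ℕ} (p : ℝ) (x : Fin d → ℝ) : Fin d → ℝ :=
  fun i => Real.sign (x i) * |x i| ^ (p - 1) / (pNorm p x) ^ (p - 1)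

variable {Ω : Type*} [mΩ : MeasurableSpace Ω] {d : ℕ}

/-- A trading strategy: `H t` is `ℱ (t-1)`-measurable for every `t ≥ 1`. -/
def IsStrategy (ℱ : Filtration ℕ mΩ) (H : ℕ → Ω → Fin d → ℝ) : Prop :=
  ∀ t : ℕ, 1 ≤ t → StronglyMeasurable[ℱ (t - 1)] (H t)

/-- The terminal gain `(H • S)_T = ∑_{t=1}^T H_t · ΔS_t`. -/
def gain (S H : ℕ → Ω → Fin d → ℝ) (T : ℕ) (ω : Ω) : ℝ :=
  ∑ t ∈ Finset.Icc 1 T, dot (H t ω) (S t ω - S (t - 1) ω)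

/-- `‖H‖_p = ∑_{t=1}^T |H_t|_p`. -/
def stratNorm (p : ℝ) (H : ℕ → Ω → Fin d → ℝ) (T : ℕ) (ω : Ω) : ℝ :=
  ∑ t ∈ Finset.Icc 1 T, pNorm p (H t ω)

/-- `H` is a strict `ε`-arbitrage. -/
def IsStrictArb (P : Measure Ω) (ℱ : Filtration ℕ mΩ) (S : ℕ → Ω → Fin d → ℝ) (T : ℕ)
    (p ε : ℝ) (H : ℕ → Ω → Fin d → ℝ) : Prop :=
  IsStrategy ℱ H ∧
    (∀ᵐ ω ∂P, 0 ≤ gain S H T ω - ε * stratNorm p H T ω) ∧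
    0 < P {ω | 0 < gain S H T ω - ε * stratNorm p H T ω}

/-- A sequence of trading strategies is an `ε`-arbitrage. -/
def IsArb (P : Measure Ω) (ℱ : Filtration ℕ mΩ) (S : ℕ → Ω → Fin d → ℝ) (T : ℕ)
    (p ε : ℝ) (H : ℕ → ℕ → Ω → Fin d → ℝ) : Prop :=
  (∀ k, IsStrategy ℱ (H k)) ∧
    (∀ᵐ ω ∂P, 0 ≤ atTop.liminf fun k => gain S (H k) T ω - ε * stratNorm p (H k) T ω) ∧
    0 < P {ω | 0 < atTop.liminf fun k => gain S (H k) T ω - ε * stratNorm p (H k) T ω}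

/-- The market satisfies `NA_ε`: there is no `ε`-arbitrage. -/
def NA (P : Measure Ω) (ℱ : Filtration ℕ mΩ) (S : ℕ → Ω → Fin d → ℝ) (T : ℕ) (p ε : ℝ) : Prop :=
  ¬ ∃ H, IsArb P ℱ S T p ε H

/-- The critical value `ε(P) = inf {ε > 0 : no strict ε-arbitrage}`, with `inf ∅ = ∞`. -/
def criticalValue (P : Measure Ω) (ℱ : Filtration ℕ mΩ) (S : ℕ → Ω → Fin d → ℝ) (T : ℕ)
    (p : ℝ) : ℝ≥0∞ :=
  sInf {x : ℝ≥0∞ | ∃ ε : ℝ, 0 < ε ∧ (¬ ∃ H, IsStrictArb P ℱ S T p ε H) ∧ x = ENNReal.ofReal ε}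

/-- `Q` is an `ε`-martingale measure: `Q` is a probability measure equivalent to `P`,
`S_T ∈ L¹(Q)` and `|E_Q[S_t | ℱ_{t-1}] - S_{t-1}|_q ≤ ε` a.s. for all `t = 1,…,T`. -/
def IsEpsMartMeasure (P : Measure Ω) (ℱ : Filtration ℕ mΩ) (S : ℕ → Ω → Fin d → ℝ) (T : ℕ)
    (p ε : ℝ) (Q : Measure Ω) : Prop :=
  IsProbabilityMeasure Q ∧ Q ≪ P ∧ P ≪ Q ∧ Integrable (S T) Q ∧
    ∀ t : ℕ, 1 ≤ t → t ≤ T →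
      ∀ᵐ ω ∂Q, qNorm p ((Q[S t | ℱ (t - 1)]) ω - S (t - 1) ω) ≤ ε

/-- `𝓜_ε(P)`: the `ε`-martingale measures with `P`-essentially bounded density `dQ/dP`. -/
def Meps (P : Measure Ω) (ℱ : Filtration ℕ mΩ) (S : ℕ → Ω → Fin d → ℝ) (T : ℕ)
    (p ε : ℝ) : Set (Measure Ω) :=
  {Q | IsEpsMartMeasure P ℱ S T p ε Q ∧ ∃ C : ℝ≥0, ∀ᵐ ω ∂P, Q.rnDeriv P ω ≤ C}

/-- `K = {(H•S)_T - ε ‖H‖_p : H ∈ 𝓗}`. -/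
def Kset (ℱ : Filtration ℕ mΩ) (S : ℕ → Ω → Fin d → ℝ) (T : ℕ) (p ε : ℝ) : Set (Ω → ℝ) :=
  {X | ∃ H, IsStrategy ℱ H ∧ X = fun ω => gain S H T ω - ε * stratNorm p H T ω}

/-- `K̄`: the closure of `K` with respect to convergence in `P`-probability. -/
def Kbar (P : Measure Ω) (ℱ : Filtration ℕ mΩ) (S : ℕ → Ω → Fin d → ℝ) (T : ℕ)
    (p ε : ℝ) : Set (Ω → ℝ) :=
  {X | ∃ Y : ℕ → Ω → ℝ, (∀ n, Y n ∈ Kset ℱ S T p ε) ∧ TendstoInMeasure P Y atTop X}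

/-- `C = {X : ∃ Y ∈ K̄, X ≤ Y a.s.}`. -/
def Cset (P : Measure Ω) (ℱ : Filtration ℕ mΩ) (S : ℕ → Ω → Fin d → ℝ) (T : ℕ)
    (p ε : ℝ) : Set (Ω → ℝ) :=
  {X | ∃ Y ∈ Kbar P ℱ S T p ε, ∀ᵐ ω ∂P, X ω ≤ Y ω}

/-- `E_{ε,t} = {H_t ∈ 𝓗_t : H_t · ΔS_t = ε |H_t|_p a.s.}`. -/
def Eset (P : Measure Ω) (ℱ : Filtration ℕ mΩ) (S : ℕ → Ω → Fin d → ℝ)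
    (p ε : ℝ) (t : ℕ) : Set (Ω → Fin d → ℝ) :=
  {h | StronglyMeasurable[ℱ (t - 1)] h ∧
    ∀ᵐ ω ∂P, dot (h ω) (S t ω - S (t - 1) ω) = ε * pNorm p (h ω)}

/-- `E_{0,t} = {H_t ∈ 𝓗_t : H_t · ΔS_t = 0 a.s.}`. -/
def E0set (P : Measure Ω) (ℱ : Filtration ℕ mΩ) (S : ℕ → Ω → Fin d → ℝ)
    (t : ℕ) : Set (Ω → Fin d → ℝ) :=
  {h | StronglyMeasurable[ℱ (t - 1)] h ∧
    ∀ᵐ ω ∂P, dot (h ω) (S t ω - S (t - 1) ω) = 0}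

/-- `E_{0,t}^⊥`. -/
def E0perp (P : Measure Ω) (ℱ : Filtration ℕ mΩ) (S : ℕ → Ω → Fin d → ℝ)
    (t : ℕ) : Set (Ω → Fin d → ℝ) :=
  {h | StronglyMeasurable[ℱ (t - 1)] h ∧
    ∀ g ∈ E0set P ℱ S t, ∀ᵐ ω ∂P, dot (h ω) (g ω) = 0}

/-- `F_{ε,t} = {X_t ∈ 𝓗_t : X_t · H_t = |X_t|_q |H_t|_p a.s. for every H_t ∈ E_{ε,t}}`. -/
def Fset (P : Measure Ω) (ℱ : Filtration ℕ mΩ) (S : ℕ → Ω → Fin d → ℝ)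
    (p ε : ℝ) (t : ℕ) : Set (Ω → Fin d → ℝ) :=
  {X | StronglyMeasurable[ℱ (t - 1)] X ∧
    ∀ h ∈ Eset P ℱ S p ε t, ∀ᵐ ω ∂P, dot (X ω) (h ω) = qNorm p (X ω) * pNorm p (h ω)}

/-- `F_{ε,t}^⊥`, depending on a fixed maximal element `H̄_t` of `E_{ε,t}` when `p = 1`. -/
def Fperp (P : Measure Ω) (ℱ : Filtration ℕ mΩ) (S : ℕ → Ω → Fin d → ℝ)
    (p ε : ℝ) (t : ℕ) (Hb : Ω → Fin d → ℝ) : Set (Ω → Fin d → ℝ) :=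
  if p = 1 then
    {h | StronglyMeasurable[ℱ (t - 1)] h ∧
      (∀ᵐ ω ∂P, dot (dualVec 1 (Hb ω)) (h ω) = 0) ∧
      ∀ i, ∀ᵐ ω ∂P, Hb ω i = 0 → h ω i = 0}
  else
    {h | StronglyMeasurable[ℱ (t - 1)] h ∧
      ∀ X ∈ Fset P ℱ S p ε t, ∀ᵐ ω ∂P, dot (X ω) (h ω) = 0}

/-- `𝓗̄_t`: strategies supported on the support of `H̄_t` (componentwise when `p = 1`). -/
def HbarSpace (P : Measure Ω) (ℱ : Filtration ℕ mΩ) (p : ℝ) (t : ℕ)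
    (Hb : Ω → Fin d → ℝ) : Set (Ω → Fin d → ℝ) :=
  if p = 1 then
    {h | StronglyMeasurable[ℱ (t - 1)] h ∧ ∀ i, ∀ᵐ ω ∂P, Hb ω i = 0 → h ω i = 0}
  else
    {h | StronglyMeasurable[ℱ (t - 1)] h ∧ ∀ᵐ ω ∂P, Hb ω = 0 → h ω = 0}

/-- The defining properties of `H̄_t`: an element of `E_{ε,t}` with `|H̄_t|_p ∈ {0,1}` a.s. of
maximal support (componentwise maximal when `p = 1`). -/
def IsMaximalEps (P : Measure Ω) (ℱ : Filtration ℕ mΩ) (S : ℕ → Ω → Fin d → ℝ)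
    (p ε : ℝ) (t : ℕ) (Hb : Ω → Fin d → ℝ) : Prop :=
  Hb ∈ Eset P ℱ S p ε t ∧
    (∀ᵐ ω ∂P, pNorm p (Hb ω) = 0 ∨ pNorm p (Hb ω) = 1) ∧
    (1 < p → P {ω | Hb ω ≠ 0} = ⨆ h ∈ Eset P ℱ S p ε t, P {ω | h ω ≠ 0}) ∧
    (p = 1 → ∀ i, P {ω | Hb ω i ≠ 0} = ⨆ h ∈ Eset P ℱ S p ε t, P {ω | h ω i ≠ 0})

/-- `F_ε^⊥ = {G ∈ 𝓗 : G_t ∈ F_{ε,t}^⊥ for every t = 1,…,T}`. -/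
def FperpStrat (P : Measure Ω) (ℱ : Filtration ℕ mΩ) (S : ℕ → Ω → Fin d → ℝ) (T : ℕ)
    (p ε : ℝ) (Hb : ℕ → Ω → Fin d → ℝ) : Set (ℕ → Ω → Fin d → ℝ) :=
  {G | ∀ t, 1 ≤ t → t ≤ T → G t ∈ Fperp P ℱ S p ε t (Hb t)}

/-- The market satisfies `NA'_ε`. -/
def NAprime (P : Measure Ω) (ℱ : Filtration ℕ mΩ) (S : ℕ → Ω → Fin d → ℝ) (T : ℕ)
    (p ε : ℝ) (Hb : ℕ → Ω → Fin d → ℝ) : Prop :=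
  (¬ ∃ H, IsStrictArb P ℱ S T p ε H) ∧
    ∀ G ∈ FperpStrat P ℱ S T p ε Hb,
      (∀ᵐ ω ∂P, 0 ≤ gain S G T ω) → ∀ᵐ ω ∂P, gain S G T ω = 0

/-- `ψ` is an `ε`-fair price for `Ψ`. -/
def IsFairPrice (P : Measure Ω) (ℱ : Filtration ℕ mΩ) (S : ℕ → Ω → Fin d → ℝ) (T : ℕ)
    (p ε : ℝ) (Ψ : Ω → ℝ) (ψ : ℝ) : Prop :=
  ∀ (H : ℕ → ℕ → Ω → Fin d → ℝ) (a : ℕ → ℝ), (∀ k, IsStrategy ℱ (H k)) →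
    (∀ᵐ ω ∂P, 0 ≤ atTop.liminf fun k =>
      gain S (H k) T ω + a k * (Ψ ω - ψ) - ε * (stratNorm p (H k) T ω + |a k|)) →
    ∀ᵐ ω ∂P, atTop.liminf (fun k =>
      gain S (H k) T ω + a k * (Ψ ω - ψ) - ε * (stratNorm p (H k) T ω + |a k|)) = 0

lemma pNorm_one {d : ℕ} (x : Fin d → ℝ) : pNorm 1 x = ∑ i, |x i| := by
  simp [pNorm]

lemma dualVec_one {d : ℕ} (x : Fin d → ℝ) (i : Fin d) : dualVec 1 x i = Real.sign (x i) := by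
  simp [dualVec]

lemma dot_add_left {d : ℕ} (x y z : Fin d → ℝ) : dot (x + y) z = dot x z + dot y z := by
  simp [dot, add_mul, Finset.sum_add_distrib]

lemma dot_smul_left {d : ℕ} (c : ℝ) (x z : Fin d → ℝ) : dot (c • x) z = c * dot x z := by
  simp [dot, Finset.mul_sum, mul_assoc]

lemma abs_add_mul_eq_sign_mul {a b c : ℝ} (h : |a| ≤ c * |b|) (hb : b = 0 → a = 0) :
    |a + c * b| = Real.sign b * a + c * |b| := by
  rcases lt_trichotomy b 0 with hb' | rfl | hb'
  · rw [abs_of_neg hb'] at h ⊢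
    rw [Real.sign_of_neg hb', abs_of_nonpos (by linarith [(abs_le.mp h).2])]
    ring
  · simp [hb rfl]
  · rw [abs_of_pos hb'] at h ⊢
    rw [Real.sign_of_pos hb', abs_of_nonneg (by linarith [(abs_le.mp h).1])]
    ring

/-- A factor `c ≥ 0` for which `|g i| ≤ c |x i|` for every `i` with `x i ≠ 0`. -/
def domFactor {d : ℕ} (g x : Fin d → ℝ) : ℝ := ∑ i, |g i| * |x i|⁻¹

lemma abs_le_domFactor_mul {d : ℕ} {g x : Fin d → ℝ} (i : Fin d) (h : x i = 0 → g i = 0) :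
    |g i| ≤ domFactor g x * |x i| := by
  by_cases hx : x i = 0
  · simp [hx, h hx]
  have hle : |g i| * |x i|⁻¹ ≤ domFactor g x :=
    Finset.single_le_sum (f := fun j => |g j| * |x j|⁻¹) (fun j _ => by positivity)
      (Finset.mem_univ i)
  calc |g i| = |g i| * |x i|⁻¹ * |x i| := by field_simp
    _ ≤ domFactor g x * |x i| := by gcongr

lemma pNorm_one_add_domFactor_smul {d : ℕ} {g x : Fin d → ℝ} (h : ∀ i, x i = 0 → g i = 0)
    (hdot : dot (dualVec 1 x) g = 0) :
    pNorm 1 (g + domFactor g x • x) = domFactor g x * pNorm 1 x := by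
  have hsum : ∑ i, Real.sign (x i) * g i = 0 := by simpa [dot, dualVec_one] using hdot
  simp only [pNorm_one, Pi.add_apply, Pi.smul_apply, smul_eq_mul]
  rw [Finset.sum_congr rfl fun i _ =>
      abs_add_mul_eq_sign_mul (abs_le_domFactor_mul i (h i)) (h i),
    Finset.sum_add_distrib, hsum, zero_add, Finset.mul_sum]

lemma StronglyMeasurable.domFactor {Ω : Type*} {m : MeasurableSpace Ω} {d : ℕ}
    {g x : Ω → Fin d → ℝ} (hg : StronglyMeasurable g) (hx : StronglyMeasurable x) :
    StronglyMeasurable fun ω => domFactor (g ω) (x ω) := by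
  have hg' := hg.measurable
  have hx' := hx.measurable
  unfold QFTAP.domFactor
  exact Measurable.stronglyMeasurable (by fun_prop)

/-- For `p = 1`, under the absence of strict `ε`-arbitrage, every
`G ∈ F_ε^⊥` satisfies `(G•S)_T = (H•S)_T - ε‖H‖₁` a.s. for some strategy `H`. -/
theorem p_one_Fperp_reachable
    {Ω : Type*} [mΩ : MeasurableSpace Ω] {d T : ℕ}
    (P : Measure Ω) [IsProbabilityMeasure P] (ℱ : Filtration ℕ mΩ)
    (S : ℕ → Ω → Fin d → ℝ) (hS : Adapted ℱ S)
    (hd : 1 ≤ d) (hT : 1 ≤ T) (ε : ℝ) (hε : 0 < ε)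
    (hNSA : ¬ ∃ H, IsStrictArb P ℱ S T 1 ε H)
    (Hb : ℕ → Ω → Fin d → ℝ)
    (hHb : ∀ t, 1 ≤ t → t ≤ T → IsMaximalEps P ℱ S 1 ε t (Hb t))
    (G : ℕ → Ω → Fin d → ℝ) (hG : G ∈ FperpStrat P ℱ S T 1 ε Hb) :
    ∃ H, IsStrategy ℱ H ∧
      ∀ᵐ ω ∂P, gain S G T ω = gain S H T ω - ε * stratNorm 1 H T ω := by
  have hperp : ∀ t, 1 ≤ t → t ≤ T → StronglyMeasurable[ℱ (t - 1)] (G t) ∧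
      (∀ᵐ ω ∂P, dot (dualVec 1 (Hb t ω)) (G t ω) = 0) ∧
      ∀ i, ∀ᵐ ω ∂P, Hb t ω i = 0 → G t ω i = 0 := fun t h1 h2 => by
    simpa [Fperp] using hG t h1 h2
  refine ⟨fun t => if t ≤ T then
    fun ω => G t ω + domFactor (G t ω) (Hb t ω) • Hb t ω else fun _ => 0, fun t h1 => ?_, ?_⟩
  · dsimp only
    split_ifs with h2
    · have hgm := (hperp t h1 h2).1
      have hbm := (hHb t h1 h2).1.1
      exact hgm.add ((StronglyMeasurable.domFactor hgm hbm).smul hbm)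
    · exact stronglyMeasurable_const
  · have hstep : ∀ t ∈ Finset.Icc 1 T, ∀ᵐ ω ∂P, dot (G t ω) (S t ω - S (t - 1) ω) =
        dot (G t ω + domFactor (G t ω) (Hb t ω) • Hb t ω) (S t ω - S (t - 1) ω) -
          ε * pNorm 1 (G t ω + domFactor (G t ω) (Hb t ω) • Hb t ω) := fun t ht => by
      obtain ⟨h1, h2⟩ := Finset.mem_Icc.mp ht
      obtain ⟨-, hdot, hsupp⟩ := hperp t h1 h2
      filter_upwards [hdot, ae_all_iff.mpr hsupp, (hHb t h1 h2).1.2] with ω hω hω' hE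
      rw [pNorm_one_add_domFactor_smul hω' hω, dot_add_left, dot_smul_left, hE]
      ring
    filter_upwards [(Finset.Icc 1 T).eventually_all.mpr hstep] with ω hω
    simp only [gain, stratNorm]
    rw [Finset.mul_sum, ← Finset.sum_sub_distrib]
    refine Finset.sum_congr rfl fun t ht => ?_
    simpa only [if_pos (Finset.mem_Icc.mp ht).2] using hω t ht

end QFTAP
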